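/- arXiv:2603.16956 — 2 statements merged into one kernel-verified Lean document; each statement's English description precedes it below -/
import Mathlib

section
/- Let G be a multigraph, k a positive integer, and S ⊆ V(G). Suppose S is 3k-edge-connected in G, every vertex in V(G) − S has degree 3, and there is no edge between vertices of V(G) − S. Let T be a set of edges of G with |T| ≤ k. Then G − T has k pairwise edge-disjoint S-subgraphs. -/
/-!
Multigraphs are modelled by a vertex type `V`, an edge type `E`, and an
incidence map `ends : E → Sym2 V` giving the (unordered) pair of endpoints
of each edge.  Subgraphs are identified with their edge sets (`Set E`).
-/

namespace SteinerPacking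

variable {V E : Type}

/-- The set of edges incident to a vertex `u` (denoted `E(u)` in the paper). -/
def incEdges (ends : E → Sym2 V) (u : V) : Set E := {e | u ∈ ends e}

/-- The degree `d(u) = |E(u)|` of a vertex. -/
noncomputable def deg (ends : E → Sym2 V) (u : V) : ℕ := (incEdges ends u).ncard

/-- One step along an edge of the edge set `F`. -/
def Step (ends : E → Sym2 V) (F : Set E) (a b : V) : Prop := ∃ e ∈ F, ends e = s(a, b)

/-- `a` and `b` are joined by a walk using only edges in `F`. -/
def Reaches (ends : E → Sym2 V) (F : Set E) (a b : V) : Prop :=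
  Relation.ReflTransGen (Step ends F) a b

/-- The vertex set `S` is connected in the subgraph with edge set `F`. -/
def ConnectsSet (ends : E → Sym2 V) (F : Set E) (S : Set V) : Prop :=
  ∀ a ∈ S, ∀ b ∈ S, Reaches ends F a b

/-- A walk from `u` to `w` given by a list of edges. -/
inductive IsWalk (ends : E → Sym2 V) : V → V → List E → Prop
  | nil (v : V) : IsWalk ends v v []
  | cons {u v w : V} {e : E} {l : List E} :
      ends e = s(u, v) → IsWalk ends v w l → IsWalk ends u w (e :: l)

/-- A path from `u` to `v` using edges of `F` (a walk with no repeated edges). -/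
def IsPathIn (ends : E → Sym2 V) (F : Set E) (u v : V) (l : List E) : Prop :=
  IsWalk ends u v l ∧ l.Nodup ∧ ∀ e ∈ l, e ∈ F

/-- There are `n` pairwise edge-disjoint paths from `u` to `v` inside `F`. -/
def EdgeDisjointPathsIn (ends : E → Sym2 V) (F : Set E) (n : ℕ) (u v : V) : Prop :=
  ∃ P : Fin n → List E, (∀ i, IsPathIn ends F u v (P i)) ∧
    ∀ i j, i ≠ j → ∀ e ∈ P i, e ∉ P j

/-- `S` is `n`-edge-connected in the (sub)graph with edge set `F`:
any two distinct vertices of `S` are joined by `n` edge-disjoint paths. -/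
def EdgeConnectedIn (ends : E → Sym2 V) (F : Set E) (S : Set V) (n : ℕ) : Prop :=
  ∀ a ∈ S, ∀ b ∈ S, a ≠ b → EdgeDisjointPathsIn ends F n a b

/-- A family of subgraphs (edge sets) is pairwise edge-disjoint. -/
def PairwiseEdgeDisjoint {k : ℕ} (H : Fin k → Set E) : Prop :=
  ∀ i j, i ≠ j → Disjoint (H i) (H j)

/-- `v` is a cut vertex of the subgraph with edge set `H`: some two vertices
distinct from `v` are connected in `H` but not after removing `v`. -/
def IsCutVertexOf (ends : E → Sym2 V) (H : Set E) (v : V) : Prop :=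
  ∃ a b : V, a ≠ v ∧ b ≠ v ∧ Reaches ends H a b ∧
    ¬ Reaches ends {e ∈ H | v ∉ ends e} a b

/-- A subpartition of `E(v)` into `k` (possibly empty) parts. -/
def IsSubpartitionAt {k : ℕ} (ends : E → Sym2 V) (v : V) (P : Fin k → Set E) : Prop :=
  (∀ i, P i ⊆ incEdges ends v) ∧ ∀ i j, i ≠ j → Disjoint (P i) (P j)

/-- A balanced partition of `E(v)` into `k` parts: each part has ≥ 2 edges. -/
def IsBalancedPartitionAt {k : ℕ} (ends : E → Sym2 V) (v : V) (P : Fin k → Set E) : Prop :=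
  IsSubpartitionAt ends v P ∧ (⋃ i, P i) = incEdges ends v ∧ ∀ i, 2 ≤ (P i).ncard

/-- A balanced subpartition of `E(v)`: one extendable to a balanced partition. -/
def IsBalancedSubpartitionAt {k : ℕ} (ends : E → Sym2 V) (v : V) (P : Fin k → Set E) : Prop :=
  IsSubpartitionAt ends v P ∧
    ∃ P' : Fin k → Set E, IsBalancedPartitionAt ends v P' ∧ ∀ i, P i ⊆ P' i

/-- The subgraphs `H 1, …, H k` extend the subpartition `P` at `v`:
`P i ⊆ H i` and `v` is not a cut vertex of any `H i`. -/
def Extend {k : ℕ} (ends : E → Sym2 V) (v : V) (P H : Fin k → Set E) : Prop :=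
  ∀ i, P i ⊆ H i ∧ ¬ IsCutVertexOf ends (H i) v

/-- The subgraphs `H 1, …, H k` balance the vertex `u`. -/
def BalanceVertex {k : ℕ} (ends : E → Sym2 V) (H : Fin k → Set E) (u : V) : Prop :=
  IsBalancedSubpartitionAt ends u (fun i => incEdges ends u ∩ H i)

/-- The subgraphs `H 1, …, H k` balance every vertex of `T`. -/
def BalanceSet {k : ℕ} (ends : E → Sym2 V) (H : Fin k → Set E) (T : Set V) : Prop :=
  ∀ u ∈ T, BalanceVertex ends H u

/-- A loopless multigraph. -/
def Loopless (ends : E → Sym2 V) : Prop := ∀ e : E, ¬ (ends e).IsDiag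

/-- The set of neighbors of a vertex. -/
def neighbors (ends : E → Sym2 V) (u : V) : Set V := {w | ∃ e, ends e = s(u, w)}

/-- The rational functions on `X` that are constant on the classes of `P`. -/
def classFunctions {X : Type} (P : Setoid X) : Submodule ℚ (X → ℚ) :=
  LinearMap.range (LinearMap.funLeft ℚ ℚ (Quotient.mk P))

theorem mem_classFunctions {X : Type} (P : Setoid X) (f : X → ℚ) :
    f ∈ classFunctions P ↔ P ≤ Setoid.ker f := by
  constructor
  · rintro ⟨g, rfl⟩ a b h
    have hq : Quotient.mk P a = Quotient.mk P b := Quotient.sound h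
    simp [LinearMap.funLeft_apply, hq]
  · intro h
    exact ⟨fun q => Quotient.lift f (fun a b hab => h hab) q, by ext a; rfl⟩

theorem finrank_classFunctions {X : Type} [Finite X] (P : Setoid X) :
    Module.finrank ℚ (classFunctions P) = Nat.card (Quotient P) := by
  have := Fintype.ofFinite (Quotient P)
  rw [classFunctions, LinearMap.finrank_range_of_inj
    (LinearMap.funLeft_injective_of_surjective ℚ ℚ _ Quotient.mk_surjective),
    Module.finrank_fintype_fun_eq_card, Nat.card_eq_fintype_card]

/-- The number of classes is supermodular on the lattice of equivalence relations. -/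
theorem card_quotient_add_card_quotient_le {X : Type} [Finite X] (P Q : Setoid X) :
    Nat.card (Quotient P) + Nat.card (Quotient Q) ≤
      Nat.card (Quotient (P ⊔ Q)) + Nat.card (Quotient (P ⊓ Q)) := by
  simp only [← finrank_classFunctions]
  rw [← Submodule.finrank_sup_add_finrank_inf_eq, add_comm]
  refine add_le_add (Submodule.finrank_mono ?_) (Submodule.finrank_mono ?_)
  · rintro f ⟨hP, hQ⟩
    exact (mem_classFunctions _ _).2
      (sup_le ((mem_classFunctions _ _).1 hP) ((mem_classFunctions _ _).1 hQ))
  · refine sup_le (fun f hf => ?_) (fun f hf => ?_) <;> rw [mem_classFunctions] at hf ⊢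
    · exact inf_le_left.trans hf
    · exact inf_le_right.trans hf

theorem card_quotient_antitone {X : Type} [Finite X] {P Q : Setoid X} (h : P ≤ Q) :
    Nat.card (Quotient Q) ≤ Nat.card (Quotient P) := by
  simp only [← finrank_classFunctions]
  refine Submodule.finrank_mono fun f hf => ?_
  rw [mem_classFunctions] at hf ⊢
  exact h.trans hf

/-- A form of Rado's theorem for an antitone supermodular function `f`. -/
theorem exists_transversal_of_supermodular {I α : Type} [Fintype I] [DecidableEq I]
    [DecidableEq α] (f : Finset α → ℕ) (hanti : Antitone f)
    (hsuper : ∀ X Y, f X + f Y ≤ f (X ∪ Y) + f (X ∩ Y)) (d : ℕ) (A : I → Finset α)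
    (hA : ∀ J : Finset I, f (J.biUnion A) ≤ d + Jᶜ.card) :
    ∃ B : I → Finset α, (∀ h, B h ⊆ A h) ∧ (∀ h, (B h).card ≤ 1) ∧
      f (Finset.univ.biUnion B) ≤ d := by
  induction hn : ∑ h, (A h).card using Nat.strong_induction_on generalizing A with
  | _ n ih =>
  by_cases hcard : ∀ h, (A h).card ≤ 1
  · exact ⟨A, fun _ => subset_rfl, hcard, by simpa using hA Finset.univ⟩
  push Not at hcard
  obtain ⟨h₀, hh₀⟩ := hcard
  obtain ⟨x, hx, y, hy, hxy⟩ := Finset.one_lt_card.1 hh₀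
  let D : α → I → Finset α := fun z => Function.update A h₀ ((A h₀).erase z)
  have hD : ∀ z h, D z h ⊆ A h := by
    intro z h
    by_cases hh : h = h₀
    · subst hh
      simp [D, Finset.erase_subset]
    · simp [D, hh]
  have step : ∀ z ∈ A h₀, (∀ J : Finset I, f (J.biUnion (D z)) ≤ d + Jᶜ.card) →
      ∃ B : I → Finset α, (∀ h, B h ⊆ A h) ∧ (∀ h, (B h).card ≤ 1) ∧
        f (Finset.univ.biUnion B) ≤ d := by
    intro z hz hJ
    have hlt : ∑ h, (D z h).card < n := by
      rw [← hn]
      refine Finset.sum_lt_sum (fun h _ => Finset.card_le_card (hD z h))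
        ⟨h₀, Finset.mem_univ _, ?_⟩
      simpa [D] using Finset.card_erase_lt_of_mem hz
    obtain ⟨B, hB, hB1, hBd⟩ := ih _ hlt (D z) hJ rfl
    exact ⟨B, fun h => (hB h).trans (hD z h), hB1, hBd⟩
  by_cases h1 : ∀ J : Finset I, f (J.biUnion (D x)) ≤ d + Jᶜ.card
  · exact step x hx h1
  by_cases h2 : ∀ J : Finset I, f (J.biUnion (D y)) ≤ d + Jᶜ.card
  · exact step y hy h2
  exfalso
  push Not at h1 h2
  obtain ⟨J₁, hJ₁⟩ := h1
  obtain ⟨J₂, hJ₂⟩ := h2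
  have hmem : ∀ z (J : Finset I), d + Jᶜ.card < f (J.biUnion (D z)) → h₀ ∈ J := by
    intro z J hJ
    by_contra hnot
    refine absurd (hA J) (not_le.2 ?_)
    have : J.biUnion (D z) = J.biUnion A := Finset.biUnion_congr rfl fun h hh => by
      have : h ≠ h₀ := fun he => hnot (he ▸ hh)
      simp [D, this]
    rwa [← this]
  have m₁ := hmem x J₁ hJ₁
  have m₂ := hmem y J₂ hJ₂
  have hU : (J₁ ∪ J₂).biUnion A ⊆ J₁.biUnion (D x) ∪ J₂.biUnion (D y) := by
    intro z hz
    simp only [Finset.mem_biUnion, Finset.mem_union] at hz ⊢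
    obtain ⟨h, hh, hz⟩ := hz
    by_cases he : h = h₀
    · subst he
      by_cases hzx : z = x
      · exact Or.inr ⟨h, m₂, by simp only [D, Function.update_self, Finset.mem_erase]; exact ⟨hzx ▸ hxy, hz⟩⟩
      · exact Or.inl ⟨h, m₁, by simp [D, hz, hzx]⟩
    · exact hh.imp (fun hh => ⟨h, hh, by simpa [D, he] using hz⟩)
        (fun hh => ⟨h, hh, by simpa [D, he] using hz⟩)
  have hI : ((J₁ ∩ J₂).erase h₀).biUnion A ⊆ J₁.biUnion (D x) ∩ J₂.biUnion (D y) := by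
    intro z hz
    simp only [Finset.mem_biUnion, Finset.mem_inter, Finset.mem_erase] at hz ⊢
    obtain ⟨h, ⟨he, hh₁, hh₂⟩, hz⟩ := hz
    exact ⟨⟨h, hh₁, by simpa [D, he] using hz⟩, ⟨h, hh₂, by simpa [D, he] using hz⟩⟩
  have e1 := hsuper (J₁.biUnion (D x)) (J₂.biUnion (D y))
  have e2 := (hanti hU).trans (hA _)
  have e3 := (hanti hI).trans (hA _)
  have c1 := Finset.card_union_add_card_inter J₁ J₂
  have c2 := Finset.card_erase_add_one (Finset.mem_inter.2 ⟨m₁, m₂⟩)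
  have c3 := Finset.card_add_card_compl J₁
  have c4 := Finset.card_add_card_compl J₂
  have c5 := Finset.card_add_card_compl (J₁ ∪ J₂)
  have c6 := Finset.card_add_card_compl ((J₁ ∩ J₂).erase h₀)
  omega

/-- A partition-connected family of equivalence relations (for instance, the hyperedges of a
partition-connected hypergraph) splits into `k` subfamilies each generating the total relation. -/
theorem exists_disjoint_iSup_eq_top {I X : Type} [Finite I] [Finite X] [Nonempty X] (k : ℕ)
    (σ : I → Setoid X)
    (hσ : ∀ P : Setoid X, k * Nat.card (Quotient P) ≤ k + {h | ¬ σ h ≤ P}.ncard) :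
    ∃ F : Fin k → Set I, (∀ i j, i ≠ j → Disjoint (F i) (F j)) ∧
      ∀ i, ⨆ h ∈ F i, σ h = ⊤ := by
  classical
  have := Fintype.ofFinite I
  let s : Finset (I × Fin k) → Fin k → Setoid X := fun F i => ⨆ h ∈ {h | (h, i) ∈ F}, σ h
  have smono : ∀ i F G, F ⊆ G → s F i ≤ s G i := fun i F G hFG =>
    biSup_mono fun h hh => hFG hh
  have ssup : ∀ i F G, s (F ∪ G) i ≤ s F i ⊔ s G i := by
    intro i F G
    refine iSup₂_le fun h hh => ?_
    rcases Finset.mem_union.1 hh with hh | hh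
    · exact (le_iSup₂ (f := fun h (_ : h ∈ {h | (h, i) ∈ F}) => σ h) h hh).trans le_sup_left
    · exact (le_iSup₂ (f := fun h (_ : h ∈ {h | (h, i) ∈ G}) => σ h) h hh).trans le_sup_right
  obtain ⟨B, hBA, hB1, hBk⟩ := exists_transversal_of_supermodular
    (fun F => ∑ i, Nat.card (Quotient (s F i)))
    (fun F G hFG => Finset.sum_le_sum fun i _ => card_quotient_antitone (smono i F G hFG))
    (fun F G => by
      simp only [← Finset.sum_add_distrib]
      refine Finset.sum_le_sum fun i _ => (card_quotient_add_card_quotient_le _ _).trans ?_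
      exact add_le_add (card_quotient_antitone (ssup i F G)) (card_quotient_antitone
        (le_inf (smono i _ _ Finset.inter_subset_left) (smono i _ _ Finset.inter_subset_right))))
    k (fun h => {h} ×ˢ Finset.univ) (by
      intro J
      have hs : ∀ i, s (J.biUnion fun h => {h} ×ˢ Finset.univ) i = ⨆ h ∈ J, σ h := by
        intro i
        simp [s]
      simp only [hs, Finset.sum_const, Finset.card_univ, Fintype.card_fin, smul_eq_mul]
      refine (hσ _).trans (Nat.add_le_add_left ?_ k)
      rw [← Set.ncard_coe_finset]
      refine Set.ncard_le_ncard (fun h hh => ?_) (Set.toFinite _)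
      simp only [Finset.coe_compl, Set.mem_compl_iff, Finset.mem_coe]
      exact fun hJ => hh (le_iSup₂ (f := fun h (_ : h ∈ J) => σ h) h hJ))
  refine ⟨fun i => {h | (h, i) ∈ Finset.univ.biUnion B}, ?_, ?_⟩
  · intro i j hij
    rw [Set.disjoint_left]
    intro h hi hj
    have key : ∀ l, (h, l) ∈ Finset.univ.biUnion B → (h, l) ∈ B h := by
      intro l hl
      obtain ⟨h', -, hl⟩ := Finset.mem_biUnion.1 hl
      have := hBA h' hl
      simp only [Finset.mem_product, Finset.mem_singleton] at this
      rwa [← this.1] at hl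
    have := Finset.card_le_one.1 (hB1 h) _ (key i hi) _ (key j hj)
    exact hij (Prod.ext_iff.1 this).2
  · intro i
    have hpos : ∀ j ∈ (Finset.univ : Finset (Fin k)),
        1 ≤ Nat.card (Quotient (s (Finset.univ.biUnion B) j)) := by
      intro j _
      have : Nonempty (Quotient (s (Finset.univ.biUnion B) j)) :=
        (inferInstance : Nonempty X).map (Quotient.mk _)
      exact Nat.card_pos
    have hsum : ∑ j : Fin k, Nat.card (Quotient (s (Finset.univ.biUnion B) j)) = ∑ j : Fin k, 1 :=
      le_antisymm (by simpa using hBk) (Finset.sum_le_sum hpos)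
    have h1 := (Finset.sum_eq_sum_iff_of_le hpos).1 hsum.symm i (Finset.mem_univ i)
    have hsub := (Nat.card_eq_one_iff_unique.1 h1.symm).1
    refine Setoid.ext fun a b => ⟨fun _ => trivial, fun _ => ?_⟩
    exact Quotient.exact (s := s (Finset.univ.biUnion B) i) (Subsingleton.elim _ _)

theorem IsWalk.exists_crossing {ends : E → Sym2 V} {u w : V} {l : List E}
    (h : IsWalk ends u w l) {X : Set V} (hu : u ∈ X) (hw : w ∉ X) :
    ∃ e ∈ l, ∃ x y, ends e = s(x, y) ∧ x ∈ X ∧ y ∉ X := by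
  induction h with
  | nil v => exact absurd hu hw
  | @cons u v w e l he _ ih =>
    by_cases hv : v ∈ X
    · obtain ⟨e', he', h⟩ := ih hv hw
      exact ⟨e', List.mem_cons_of_mem _ he', h⟩
    · exact ⟨e, List.mem_cons_self, u, v, he, hu, hv⟩

open Classical in
/-- The hyperedge on `S` containing the edge `e`: all edges at a common vertex outside `S` form one
hyperedge, and each edge inside `S` is a hyperedge by itself. -/
noncomputable def hyperedge (ends : E → Sym2 V) (S : Set V) (e : E) : V ⊕ E :=
  if h : ∃ v ∈ ends e, v ∉ S then Sum.inl h.choose else Sum.inr e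

theorem hyperedge_eq_inl {ends : E → Sym2 V} {S : Set V} {e : E} {v : V}
    (h : hyperedge ends S e = Sum.inl v) : v ∈ ends e ∧ v ∉ S := by
  unfold hyperedge at h
  split_ifs at h with hv
  exact Sum.inl.inj h ▸ hv.choose_spec

theorem hyperedge_eq_inr {ends : E → Sym2 V} {S : Set V} {e e' : E}
    (h : hyperedge ends S e = Sum.inr e') : e = e' ∧ ∀ v ∈ ends e, v ∈ S := by
  unfold hyperedge at h
  split_ifs at h with hv
  exact ⟨Sum.inr.inj h, by simpa using hv⟩

theorem hyperedge_of_notMem {ends : E → Sym2 V} {S : Set V}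
    (hindep : ∀ e : E, ∃ x ∈ ends e, x ∈ S) {e : E} {v : V} (hv : v ∈ ends e) (hS : v ∉ S) :
    hyperedge ends S e = Sum.inl v := by
  have hex : ∃ v ∈ ends e, v ∉ S := ⟨v, hv, hS⟩
  unfold hyperedge
  rw [dif_pos hex]
  obtain ⟨x, hx, hxS⟩ := hindep e
  have hne : x ≠ v := fun h => hS (h ▸ hxS)
  have hends := (Sym2.mem_and_mem_iff hne).1 ⟨hx, hv⟩
  have hc := hex.choose_spec
  have hor := Sym2.mem_iff.1 (hends.subst (motive := fun z => hex.choose ∈ z) hc.1)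
  rcases hor with h | h
  · exact absurd hxS (h ▸ hc.2)
  · rw [h]

/-- The vertices of `S` on the hyperedge `h` after restricting to the edges in `F`. -/
def hyperedgeVertices (ends : E → Sym2 V) (S : Set V) (F : Set E) (h : V ⊕ E) : Set V :=
  {x | x ∈ S ∧ ∃ e ∈ F, hyperedge ends S e = h ∧ x ∈ ends e}

theorem ncard_hyperedgeVertices_le [Finite V] [Finite E] {ends : E → Sym2 V} {S : Set V}
    (hdeg : ∀ u : V, u ∉ S → deg ends u = 3) (F : Set E) (h : V ⊕ E) :
    (hyperedgeVertices ends S F h).ncard ≤ 3 := by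
  classical
  rcases h with v | e
  · rcases (hyperedgeVertices ends S F (Sum.inl v)).eq_empty_or_nonempty with h0 | ⟨x, hx⟩
    · simp [h0]
    have hvS : v ∉ S := by
      obtain ⟨-, e, -, he, -⟩ := hx
      exact (hyperedge_eq_inl he).2
    rw [← hdeg v hvS]
    have hex : ∀ y ∈ hyperedgeVertices ends S F (Sum.inl v), ∃ e, ends e = s(y, v) := by
      rintro y ⟨hy, e, -, he, hye⟩
      have hne : y ≠ v := fun h => hvS (h ▸ hy)
      exact ⟨e, (Sym2.mem_and_mem_iff hne).1 ⟨hye, (hyperedge_eq_inl he).1⟩⟩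
    have : Nonempty E := ⟨(hex x hx).choose⟩
    choose! g hg using hex
    refine Set.ncard_le_ncard_of_injOn g (fun y hy => ?_) (fun y hy z hz hyz => ?_) (Set.toFinite _)
    · simp [incEdges, hg y hy]
    · have := (hg y hy).symm.trans (hyz ▸ hg z hz)
      exact Sym2.congr_left.1 this
  · obtain ⟨a, b, hab⟩ : ∃ a b, ends e = s(a, b) := ⟨_, _, (Quot.out_eq (ends e)).symm⟩
    have : hyperedgeVertices ends S F (Sum.inr e) ⊆ {a, b} := by
      rintro x ⟨-, e', -, he, hx⟩
      rw [(hyperedge_eq_inr he).1, hab, Sym2.mem_iff] at hx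
      exact hx
    exact (Set.ncard_le_ncard this (Set.toFinite _)).trans ((Set.ncard_insert_le _ _).trans (by simp))

/-- Every cut of `S` is crossed by as many hyperedges as `S` has edge-connectivity. -/
theorem le_ncard_crossing_hyperedges [Finite V] [Finite E] {ends : E → Sym2 V} {S : Set V}
    (hdeg : ∀ u : V, u ∉ S → deg ends u = 3)
    (hindep : ∀ e : E, ∃ x ∈ ends e, x ∈ S) {n : ℕ}
    (hconn : EdgeConnectedIn ends Set.univ S n) {C : Set V} (hCS : C ⊆ S) {a b : V}
    (ha : a ∈ C) (hb : b ∈ S) (hbC : b ∉ C) :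
    n ≤ {h | ∃ x ∈ hyperedgeVertices ends S Set.univ h,
      ∃ y ∈ hyperedgeVertices ends S Set.univ h, x ∈ C ∧ y ∉ C}.ncard := by
  classical
  obtain ⟨p, hp, hdisj⟩ := hconn a (hCS ha) b hb (fun h => hbC (h ▸ ha))
  let into : V → Set E := fun v => {e ∈ incEdges ends v | ∃ c ∈ C, c ∈ ends e}
  let out : V → Set E := fun v => {e ∈ incEdges ends v | ¬ ∃ c ∈ C, c ∈ ends e}
  have hio : ∀ v, v ∉ S → (into v).ncard + (out v).ncard = 3 := by
    intro v hv
    rw [← hdeg v hv, deg]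
    have hsub : into v ⊆ incEdges ends v := Set.sep_subset _ _
    have : out v = incEdges ends v \ into v := by
      ext e
      exact ⟨fun h => ⟨h.1, fun h' => h.2 h'.2⟩, fun h => ⟨h.1, fun h' => h.2 ⟨h.1, h'⟩⟩⟩
    rw [this, add_comm, Set.ncard_sdiff_add_ncard_of_subset hsub]
  let X : Set V := C ∪ {v | v ∉ S ∧ 2 ≤ (into v).ncard}
  have haX : a ∈ X := Or.inl ha
  have hbX : b ∉ X := by
    rintro (h | h)
    · exact hbC h
    · exact h.1 hb
  choose e he x y hxy hx hy using fun i => (hp i).1.exists_crossing haX hbX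
  have hother : ∀ v, v ∉ S → ∀ e, v ∈ ends e → ∃ w ∈ S, ends e = s(v, w) := by
    intro v hv e hve
    obtain ⟨w, hw, hwS⟩ := hindep e
    have hne : v ≠ w := fun h => hv (h ▸ hwS)
    exact ⟨w, hwS, (Sym2.mem_and_mem_iff hne).1 ⟨hve, hw⟩⟩
  have hinS : ∀ v ∈ S, v ∈ X ↔ v ∈ C := fun v hv =>
    ⟨fun h => h.elim id fun h => absurd hv h.1, Or.inl⟩
  have hcase : ∀ i v, v ∉ S → v ∈ ends (e i) →
      (v ∈ X ∧ e i ∈ out v) ∨ (v ∉ X ∧ e i ∈ into v) := by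
    intro i v hv hve
    obtain ⟨w, hwS, hw⟩ := hother v hv _ hve
    have hvC : v ∉ C := fun h => hv (hCS h)
    have := hxy i
    rw [hw, Sym2.eq_iff] at this
    rcases this with ⟨h1, h2⟩ | ⟨h1, h2⟩
    · refine Or.inl ⟨h1 ▸ hx i, hve, ?_⟩
      have hwC : w ∉ C := fun h => hy i (h2 ▸ Or.inl h)
      rw [hw]
      rintro ⟨c, hc, hcm⟩
      rcases Sym2.mem_iff.1 hcm with rfl | rfl
      · exact hvC hc
      · exact hwC hc
    · refine Or.inr ⟨h1 ▸ hy i, hve, w, ?_, hw ▸ Sym2.mem_mk_right _ _⟩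
      exact (hinS w hwS).1 (h2 ▸ hx i)
  have hle : ∀ v, v ∉ S → (v ∈ X → (out v).ncard ≤ 1) ∧ (v ∉ X → (into v).ncard ≤ 1) := by
    intro v hv
    have h3 := hio v hv
    refine ⟨fun h => ?_, fun h => ?_⟩
    · have : 2 ≤ (into v).ncard := h.elim (fun h => absurd (hCS h) hv) fun h => h.2
      omega
    · by_contra hlt
      exact h (Or.inr ⟨hv, by omega⟩)
  have hinj : Function.Injective fun i => hyperedge ends S (e i) := by
    intro i j hij
    have heq : e i = e j := by
      simp only at hij
      rcases hh : hyperedge ends S (e i) with v | e'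
      · have hi := hyperedge_eq_inl hh
        have hj := hyperedge_eq_inl (hij.symm.trans hh)
        have hl := hle v hi.2
        rcases hcase i v hi.2 hi.1 with ⟨hvX, h1⟩ | ⟨hvX, h1⟩ <;>
          rcases hcase j v hi.2 hj.1 with ⟨hvX', h2⟩ | ⟨hvX', h2⟩
        · exact (Set.ncard_le_one (Set.toFinite _)).1 (hl.1 hvX) _ h1 _ h2
        · exact absurd hvX hvX'
        · exact absurd hvX' hvX
        · exact (Set.ncard_le_one (Set.toFinite _)).1 (hl.2 hvX) _ h1 _ h2
      · exact (hyperedge_eq_inr hh).1.trans (hyperedge_eq_inr (hij.symm.trans hh)).1.symm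
    by_contra hne
    exact hdisj i j hne _ (he i) (heq ▸ he j)
  have hmem_in : ∀ v, v ∉ S → ∀ e ∈ into v,
      ∃ z ∈ hyperedgeVertices ends S Set.univ (Sum.inl v), z ∈ C := by
    rintro v hv e ⟨hve, c, hc, hce⟩
    exact ⟨c, ⟨hCS hc, e, trivial, hyperedge_of_notMem hindep hve hv, hce⟩, hc⟩
  have hmem_out : ∀ v, v ∉ S → ∀ e ∈ out v,
      ∃ z ∈ hyperedgeVertices ends S Set.univ (Sum.inl v), z ∉ C := by
    rintro v hv e ⟨hve, hc⟩
    obtain ⟨w, hwS, hw⟩ := hother v hv e hve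
    have hwe : w ∈ ends e := hw ▸ Sym2.mem_mk_right _ _
    exact ⟨w, ⟨hwS, e, trivial, hyperedge_of_notMem hindep hve hv, hwe⟩, fun h => hc ⟨w, h, hwe⟩⟩
  have hcross : Set.range (fun i => hyperedge ends S (e i)) ⊆
      {h | ∃ x ∈ hyperedgeVertices ends S Set.univ h,
        ∃ y ∈ hyperedgeVertices ends S Set.univ h, x ∈ C ∧ y ∉ C} := by
    rintro _ ⟨i, rfl⟩
    simp only [Set.mem_ofPred_eq]
    rcases hh : hyperedge ends S (e i) with v | e'
    · have hi := hyperedge_eq_inl hh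
      have h3 := hio v hi.2
      have hl := hle v hi.2
      have hboth : (into v).Nonempty ∧ (out v).Nonempty := by
        rcases hcase i v hi.2 hi.1 with ⟨hvX, h1⟩ | ⟨hvX, h1⟩
        · have := hl.1 hvX
          exact ⟨Set.nonempty_of_ncard_ne_zero (by omega), ⟨_, h1⟩⟩
        · have := hl.2 hvX
          exact ⟨⟨_, h1⟩, Set.nonempty_of_ncard_ne_zero (by omega)⟩
      obtain ⟨⟨e₁, h1⟩, ⟨e₂, h2⟩⟩ := hboth
      obtain ⟨z, hz, hzC⟩ := hmem_in v hi.2 _ h1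
      obtain ⟨w, hw, hwC⟩ := hmem_out v hi.2 _ h2
      exact ⟨z, hz, w, hw, hzC, hwC⟩
    · have hi := hyperedge_eq_inr hh
      have hxe : x i ∈ ends (e i) := hxy i ▸ Sym2.mem_mk_left _ _
      have hye : y i ∈ ends (e i) := hxy i ▸ Sym2.mem_mk_right _ _
      exact ⟨x i, ⟨hi.2 _ hxe, e i, trivial, hh, hxe⟩, y i, ⟨hi.2 _ hye, e i, trivial, hh, hye⟩,
        (hinS _ (hi.2 _ hxe)).1 (hx i), fun h => hy i (Or.inl h)⟩
  calc n = (Set.range fun i => hyperedge ends S (e i)).ncard := by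
        rw [← Set.image_univ, Set.ncard_image_of_injective _ hinj, Set.ncard_univ, Nat.card_fin]
    _ ≤ _ := Set.ncard_le_ncard hcross (Set.toFinite _)

/-- The equivalence relation on `S` generated by the hyperedge `h`, restricted to `F`. -/
def hyperedgeSetoid (ends : E → Sym2 V) (S : Set V) (F : Set E) (h : V ⊕ E) : Setoid S :=
  sInf {P | ∀ a b : S, ↑a ∈ hyperedgeVertices ends S F h → ↑b ∈ hyperedgeVertices ends S F h →
    P a b}

theorem hyperedgeSetoid_le_iff {ends : E → Sym2 V} {S : Set V} {F : Set E} {h : V ⊕ E}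
    {P : Setoid S} : hyperedgeSetoid ends S F h ≤ P ↔
      ∀ a b : S, ↑a ∈ hyperedgeVertices ends S F h → ↑b ∈ hyperedgeVertices ends S F h →
        P a b := by
  refine ⟨fun hle a b ha hb => hle ?_, fun hP => sInf_le hP⟩
  exact fun Q hQ => hQ a b ha hb

/-- Without deletions, a partition of `S` into `m ≥ 2` classes is crossed by at least `k * m`
hyperedges. -/
theorem mul_card_quotient_le_ncard_crossing [Finite V] [Finite E] {ends : E → Sym2 V} {k : ℕ}
    {S : Set V} (hconn : EdgeConnectedIn ends Set.univ S (3 * k))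
    (hdeg : ∀ u : V, u ∉ S → deg ends u = 3)
    (hindep : ∀ e : E, ∃ x ∈ ends e, x ∈ S) (P : Setoid S) (hP : 1 < Nat.card (Quotient P)) :
    k * Nat.card (Quotient P) ≤ {h | ¬ hyperedgeSetoid ends S Set.univ h ≤ P}.ncard := by
  classical
  have := Fintype.ofFinite (Quotient P)
  have := Fintype.ofFinite V
  have := Fintype.ofFinite E
  have hnt : Nontrivial (Quotient P) := Finite.one_lt_card_iff_nontrivial.1 hP
  let N := hyperedgeVertices ends S Set.univ
  let cls : Quotient P → Set V := fun q => {x | ∃ hx : x ∈ S, Quotient.mk P ⟨x, hx⟩ = q}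
  let R : Quotient P → V ⊕ E → Prop := fun q h => ∃ x ∈ N h, ∃ y ∈ N h, x ∈ cls q ∧ y ∉ cls q
  let K : Finset (V ⊕ E) := Finset.univ.filter fun h => ¬ hyperedgeSetoid ends S Set.univ h ≤ P
  have hRK : ∀ q h, R q h → h ∈ K := by
    rintro q h ⟨x, hx, y, hy, ⟨hxS, hxq⟩, hyq⟩
    simp only [K, Finset.mem_filter, Finset.mem_univ, true_and, hyperedgeSetoid_le_iff]
    intro hall
    refine hyq ⟨hy.1, ?_⟩
    rw [← hxq]
    exact Quotient.sound (hall ⟨y, hy.1⟩ ⟨x, hxS⟩ hy hx)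
  have hlow : ∀ q ∈ (Finset.univ : Finset (Quotient P)), 3 * k ≤ (K.bipartiteAbove R q).card := by
    intro q _
    obtain ⟨⟨a, haS⟩, ha⟩ := Quotient.exists_rep q
    obtain ⟨q', hq'⟩ := exists_ne q
    obtain ⟨⟨b, hbS⟩, hb⟩ := Quotient.exists_rep q'
    have := le_ncard_crossing_hyperedges hdeg hindep hconn (C := cls q) (fun x hx => hx.1)
      (a := a) (b := b) ⟨haS, ha⟩ hbS (fun h => hq' (hb.symm.trans h.2))
    refine this.trans ?_
    rw [← Set.ncard_coe_finset]
    refine Set.ncard_le_ncard (fun h hh => ?_) (Set.toFinite _)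
    simp only [Finset.coe_bipartiteAbove]
    exact ⟨hRK q h hh, hh⟩
  have hupp : ∀ h ∈ K, ((Finset.univ : Finset (Quotient P)).bipartiteBelow R h).card ≤ 3 := by
    intro h _
    refine le_trans ?_ (ncard_hyperedgeVertices_le hdeg Set.univ h)
    rw [← Set.ncard_coe_finset]
    have hex : ∀ q, R q h → ∃ x ∈ N h, x ∈ cls q := fun q ⟨x, hx, _, _, hq, _⟩ => ⟨x, hx, hq⟩
    have : Nonempty V := (isEmpty_or_nonempty V).resolve_left fun _ =>
      (Quotient.exists_rep hnt.to_nonempty.some).elim fun a _ => isEmptyElim a.1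
    choose! g hg hgq using hex
    refine Set.ncard_le_ncard_of_injOn g (fun q hq => ?_) (fun q hq q' hq' hqq => ?_)
      (Set.toFinite _)
    · exact hg q (by simpa [Finset.bipartiteBelow] using hq)
    · obtain ⟨h1, h2⟩ := hgq q (by simpa [Finset.bipartiteBelow] using hq)
      obtain ⟨h3, h4⟩ := hgq q' (by simpa [Finset.bipartiteBelow] using hq')
      rw [← h2, ← h4]
      congr 1
      exact Subtype.ext hqq
  have hdc := Finset.card_mul_le_card_mul R hlow hupp
  have hK : {h | ¬ hyperedgeSetoid ends S Set.univ h ≤ P}.ncard = K.card := by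
    rw [← Set.ncard_coe_finset]
    simp [K]
  rw [hK, Nat.card_eq_fintype_card]
  rw [Finset.card_univ] at hdc
  nlinarith

/-- Deleting the edges in `T` destroys the crossing of at most `|T|` hyperedges. -/
theorem ncard_crossing_le_add_ncard [Finite V] [Finite E] (ends : E → Sym2 V) (S : Set V)
    (T : Set E) (P : Setoid S) :
    {h | ¬ hyperedgeSetoid ends S Set.univ h ≤ P}.ncard ≤
      {h | ¬ hyperedgeSetoid ends S Tᶜ h ≤ P}.ncard + T.ncard := by
  have hsub : {h | ¬ hyperedgeSetoid ends S Set.univ h ≤ P} ⊆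
      {h | ¬ hyperedgeSetoid ends S Tᶜ h ≤ P} ∪ hyperedge ends S '' T := by
    intro h hh
    by_contra hnot
    simp only [Set.mem_union, Set.mem_ofPred_eq, not_or, not_not] at hnot
    refine hh (hyperedgeSetoid_le_iff.2 fun a b ha hb => hyperedgeSetoid_le_iff.1 hnot.1 a b ?_ ?_)
    · obtain ⟨hS, e, -, he, hae⟩ := ha
      exact ⟨hS, e, fun heT => hnot.2 ⟨e, heT, he⟩, he, hae⟩
    · obtain ⟨hS, e, -, he, hae⟩ := hb
      exact ⟨hS, e, fun heT => hnot.2 ⟨e, heT, he⟩, he, hae⟩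
  refine (Set.ncard_le_ncard hsub (Set.toFinite _)).trans ((Set.ncard_union_le _ _).trans ?_)
  exact Nat.add_le_add_left (Set.ncard_image_le (Set.toFinite _)) _

theorem Step.symm {ends : E → Sym2 V} {F : Set E} {a b : V} (h : Step ends F a b) :
    Step ends F b a := by
  obtain ⟨e, he, h⟩ := h
  exact ⟨e, he, h.trans Sym2.eq_swap⟩

theorem Reaches.symm {ends : E → Sym2 V} {F : Set E} {a b : V} (h : Reaches ends F a b) :
    Reaches ends F b a := by
  induction h with
  | refl => exact Relation.ReflTransGen.refl
  | tail _ hs ih => exact Relation.ReflTransGen.head hs.symm ih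

/-- The relation of being joined inside `F`, on the vertices in `S`. -/
def reachesSetoid (ends : E → Sym2 V) (F : Set E) (S : Set V) : Setoid S where
  r a b := Reaches ends F a b
  iseqv := ⟨fun _ => Relation.ReflTransGen.refl, Reaches.symm, Relation.ReflTransGen.trans⟩

theorem hyperedgeSetoid_le_reachesSetoid {ends : E → Sym2 V} {S : Set V} {F H : Set E}
    {h : V ⊕ E} (hH : ∀ e ∈ F, hyperedge ends S e = h → e ∈ H) :
    hyperedgeSetoid ends S F h ≤ reachesSetoid ends H S := by
  rw [hyperedgeSetoid_le_iff]
  rintro ⟨a, haS⟩ ⟨b, hbS⟩ ⟨-, e, he, hea, hae⟩ ⟨-, e', he', heb, hbe⟩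
  change Reaches ends H a b
  rcases h with v | e₀
  · obtain ⟨hve, hvS⟩ := hyperedge_eq_inl hea
    obtain ⟨hve', -⟩ := hyperedge_eq_inl heb
    have hav : a ≠ v := fun h => hvS (h ▸ haS)
    have hbv : b ≠ v := fun h => hvS (h ▸ hbS)
    have h1 : Step ends H a v := ⟨e, hH e he hea, (Sym2.mem_and_mem_iff hav).1 ⟨hae, hve⟩⟩
    have h2 : Step ends H b v := ⟨e', hH e' he' heb, (Sym2.mem_and_mem_iff hbv).1 ⟨hbe, hve'⟩⟩
    exact (Relation.ReflTransGen.single h1).tail h2.symm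
  · by_cases hab : a = b
    · subst hab
      exact Relation.ReflTransGen.refl
    · have hee : e' = e := (hyperedge_eq_inr heb).1.trans (hyperedge_eq_inr hea).1.symm
      rw [hee] at hbe
      exact Relation.ReflTransGen.single
        ⟨e, hH e he hea, (Sym2.mem_and_mem_iff hab).1 ⟨hae, hbe⟩⟩

/-- If `S` is `3k`-edge-connected in `G`, every vertex of
`V(G) − S` has degree `3`, there is no edge between vertices of `V(G) − S`,
and `T` is a set of at most `k` edges, then `G − T` has `k` pairwise
edge-disjoint `S`-subgraphs. -/
theorem tree_packing_after_deletion {V E : Type} [Fintype V] [Fintype E]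
    (ends : E → Sym2 V) (k : ℕ) (hk : 0 < k) (S : Set V)
    (hconn : EdgeConnectedIn ends Set.univ S (3 * k))
    (hdeg : ∀ u : V, u ∉ S → deg ends u = 3)
    (hindep : ∀ e : E, ∃ x ∈ ends e, x ∈ S)
    (T : Set E) (hT : T.ncard ≤ k) :
    ∃ H : Fin k → Set E, PairwiseEdgeDisjoint H ∧
      ∀ i, H i ⊆ Tᶜ ∧ ConnectsSet ends (H i) S := by
  rcases S.eq_empty_or_nonempty with rfl | hne
  · exact ⟨fun _ => ∅, fun _ _ _ => disjoint_bot_left,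
      fun _ => ⟨Set.empty_subset _, fun a ha => absurd ha (Set.notMem_empty a)⟩⟩
  have : Nonempty S := hne.to_subtype
  obtain ⟨F, hF, htop⟩ := exists_disjoint_iSup_eq_top k (hyperedgeSetoid ends S Tᶜ) (by
    intro P
    by_cases hP : 1 < Nat.card (Quotient P)
    · have h1 := mul_card_quotient_le_ncard_crossing hconn hdeg hindep P hP
      have h2 := ncard_crossing_le_add_ncard ends S T P
      omega
    · have := Nat.mul_le_mul_left k (not_lt.1 hP)
      omega)
  refine ⟨fun i => {e | e ∈ Tᶜ ∧ hyperedge ends S e ∈ F i}, fun i j hij => ?_, fun i =>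
    ⟨fun e he => he.1, fun a ha b hb => ?_⟩⟩
  · rw [Set.disjoint_left]
    exact fun e hi hj => Set.disjoint_left.1 (hF i j hij) hi.2 hj.2
  · have hle : (⊤ : Setoid S) ≤
        reachesSetoid ends {e | e ∈ Tᶜ ∧ hyperedge ends S e ∈ F i} S := by
      rw [← htop i]
      exact iSup₂_le fun h hh =>
        hyperedgeSetoid_le_reachesSetoid fun e he heq => ⟨he, heq ▸ hh⟩
    exact hle (x := ⟨a, ha⟩) (y := ⟨b, hb⟩) trivial

end SteinerPacking
end

section
/- Let G be a multigraph and let v_1, v_2 be vertices of G. If v_1 and v_2 have 2λ+1 common paths in G, then there exist λ+1 pairwise edge-disjoint paths from v_1 to v_2 in G. -/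
/-!
Multigraphs are modelled by a vertex type `V`, an edge type `E`, and an
incidence map `ends : E → Sym2 V` giving the (unordered) pair of endpoints
of each edge.  Subgraphs are identified with their edge sets (`Set E`).
-/

namespace SteinerPacking

variable {V E : Type}

/-- `v1` and `v2` have `n` common paths: `n` pairwise edge-disjoint paths
starting at `v1`, `n` pairwise edge-disjoint paths starting at `v2`, and a
bijection (after reindexing, the identity) matching paths with the same
endpoint.  The empty path from a vertex to itself is allowed. -/
def CommonPaths (ends : E → Sym2 V) (n : ℕ) (v1 v2 : V) : Prop :=
  ∃ (P Q : Fin n → List E) (t : Fin n → V),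
    (∀ i, IsPathIn ends Set.univ v1 (t i) (P i)) ∧
    (∀ i, IsPathIn ends Set.univ v2 (t i) (Q i)) ∧
    (∀ i j, i ≠ j → ∀ e ∈ P i, e ∉ P j) ∧
    (∀ i j, i ≠ j → ∀ e ∈ Q i, e ∉ Q j)

theorem IsWalk.concat {ends : E → Sym2 V} {u v w : V} {p : List E} {e : E}
    (h : IsWalk ends u v p) (he : ends e = s(v, w)) : IsWalk ends u w (p ++ [e]) := by
  induction h with
  | nil v => exact .cons he (.nil w)
  | cons h₁ _ ih => exact .cons h₁ (ih he)

/-- A walk leaving a vertex set uses an edge with exactly one end in the set. -/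
theorem IsWalk.exists_crossing_s10 {tail head : E → V} {T : Set V} {u v : V} {p : List E}
    (h : IsWalk (fun e => s(tail e, head e)) u v p) (huv : ¬(u ∈ T ↔ v ∈ T)) :
    ∃ e ∈ p, ¬(tail e ∈ T ↔ head e ∈ T) := by
  induction h with
  | nil v => exact absurd Iff.rfl huv
  | @cons u v w e p he _ ih =>
    by_cases hv : v ∈ T ↔ w ∈ T
    · refine ⟨e, List.mem_cons_self, ?_⟩
      rcases Sym2.eq_iff.1 he with ⟨h₁, h₂⟩ | ⟨h₁, h₂⟩ <;> rw [h₁, h₂] <;> tauto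
    · obtain ⟨e', he', hc⟩ := ih hv
      exact ⟨e', List.mem_cons_of_mem _ he', hc⟩

/-- `f` is an integral flow of value `k` from `a` to `b` (edge `e` being oriented from `tail e` to
`head e`), where flow conservation is expressed by pairing with vertex potentials. -/
def IsFlow [Fintype E] (tail head : E → V) (a b : V) (k : ℤ) (f : E → ℤ) : Prop :=
  ∀ φ : V → ℤ, ∑ e, f e * (φ (tail e) - φ (head e)) = k * (φ a - φ b)

theorem IsFlow.add [Fintype E] {tail head : E → V} {a b : V} {k m : ℤ} {f g : E → ℤ}
    (hf : IsFlow tail head a b k f) (hg : IsFlow tail head a b m g) :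
    IsFlow tail head a b (k + m) (fun e => f e + g e) := fun φ => by
  simp only [add_mul, Finset.sum_add_distrib, hf φ, hg φ]

theorem IsFlow.sub [Fintype E] {tail head : E → V} {a b : V} {k m : ℤ} {f g : E → ℤ}
    (hf : IsFlow tail head a b k f) (hg : IsFlow tail head a b m g) :
    IsFlow tail head a b (k - m) (fun e => f e - g e) := fun φ => by
  simp only [sub_mul, Finset.sum_sub_distrib, hf φ, hg φ]

/-- `g` is the unit flow along a trail `p` from `a` to `x`, all of whose steps satisfy `R`;
a step is an edge together with the sign `±1` of the direction of traversal. -/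
structure IsUnitFlowAlong [Fintype E] (tail head : E → V) (R : E → ℤ → Prop) (a x : V)
    (p : List E) (g : E → ℤ) : Prop where
  isWalk : IsWalk (fun e => s(tail e, head e)) a x p
  nodup : p.Nodup
  isFlow : IsFlow tail head a x 1 g
  eq_zero : ∀ e ∉ p, g e = 0
  step : ∀ e ∈ p, (g e = 1 ∨ g e = -1) ∧ R e (g e)

theorem IsUnitFlowAlong.concat [Fintype E] {tail head : E → V} {R : E → ℤ → Prop} {a x y : V}
    {p : List E} {g : E → ℤ} (h : IsUnitFlowAlong tail head R a x p g) {e : E} {s : ℤ}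
    (he : e ∉ p) (hR : R e s)
    (hs : s = 1 ∧ tail e = x ∧ head e = y ∨ s = -1 ∧ head e = x ∧ tail e = y) :
    ∃ g', IsUnitFlowAlong tail head R a y (p ++ [e]) g' := by
  classical
  refine ⟨fun i => g i + if i = e then s else 0, ?_, ?_, ?_, ?_, ?_⟩
  · refine h.isWalk.concat (Sym2.eq_iff.2 ?_)
    tauto
  · rw [List.nodup_append]
    refine ⟨h.nodup, List.nodup_singleton e, ?_⟩
    intro i hi j hj hij
    simp only [List.mem_singleton] at hj
    exact he (hj ▸ hij ▸ hi)
  · intro φ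
    simp only [add_mul, Finset.sum_add_distrib, h.isFlow φ, ite_mul, zero_mul,
      Finset.sum_ite_eq', Finset.mem_univ, if_true]
    rcases hs with ⟨rfl, rfl, rfl⟩ | ⟨rfl, rfl, rfl⟩ <;> ring
  · intro i hi
    simp only [List.mem_append, List.mem_singleton, not_or] at hi
    simp [h.eq_zero i hi.1, hi.2]
  · intro i hi
    rcases List.mem_append.1 hi with hi | hi
    · have hne : i ≠ e := fun hie => he (hie ▸ hi)
      simpa [hne] using h.step i hi
    · obtain rfl := List.mem_singleton.1 hi
      simp only [h.eq_zero i he, if_true, zero_add]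
      exact ⟨by tauto, hR⟩

/-- The set of vertices reachable from `a` by steps satisfying `R`: it is closed under such steps,
and each of its vertices is the end of a trail from `a`. -/
theorem exists_closed_set_unitFlow [Fintype E] (tail head : E → V) (R : E → ℤ → Prop) (a : V) :
    ∃ T : Set V, a ∈ T ∧ (∀ e, R e 1 → tail e ∈ T → head e ∈ T) ∧
      (∀ e, R e (-1) → head e ∈ T → tail e ∈ T) ∧
      ∀ x ∈ T, ∃ p g, IsUnitFlowAlong tail head R a x p g := by
  let Good : Set V → Prop := fun S => ∀ x ∈ S, ∃ p g, IsUnitFlowAlong tail head R a x p g ∧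
    ∀ e ∈ p, tail e ∈ S ∧ head e ∈ S
  have good_union : Good (⋃₀ {S | Good S}) := by
    rintro x ⟨S, hS, hx⟩
    obtain ⟨p, g, h, hp⟩ := hS x hx
    exact ⟨p, g, h, fun e he => ⟨⟨S, hS, (hp e he).1⟩, ⟨S, hS, (hp e he).2⟩⟩⟩
  have closed : ∀ e s x y, x ∈ ⋃₀ {S | Good S} → R e s →
      (s = 1 ∧ tail e = x ∧ head e = y ∨ s = -1 ∧ head e = x ∧ tail e = y) →
      y ∈ ⋃₀ {S | Good S} := by
    intro e s x y hx hR hs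
    by_contra hy
    refine hy ⟨insert y (⋃₀ {S | Good S}), ?_, Set.mem_insert _ _⟩
    rintro z (rfl | hz)
    · obtain ⟨p, g, h, hp⟩ := good_union x hx
      have he : e ∉ p := fun he => by
        have := hp e he
        rcases hs with ⟨-, -, rfl⟩ | ⟨-, -, rfl⟩
        exacts [hy this.2, hy this.1]
      obtain ⟨g', hg'⟩ := h.concat he hR hs
      refine ⟨_, g', hg', fun i hi => ?_⟩
      rcases List.mem_append.1 hi with hi | hi
      · exact ⟨.inr (hp i hi).1, .inr (hp i hi).2⟩
      · obtain rfl := List.mem_singleton.1 hi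
        rcases hs with ⟨-, rfl, rfl⟩ | ⟨-, rfl, rfl⟩
        exacts [⟨.inr hx, .inl rfl⟩, ⟨.inl rfl, .inr hx⟩]
    · obtain ⟨p, g, h, hp⟩ := good_union z hz
      exact ⟨p, g, h, fun i hi => ⟨.inr (hp i hi).1, .inr (hp i hi).2⟩⟩
  refine ⟨⋃₀ {S | Good S}, ⟨{a}, ?_, rfl⟩, fun e hR h => closed e 1 _ _ h hR (by simp),
    fun e hR h => closed e (-1) _ _ h hR (by simp), fun x hx => ?_⟩
  · rintro x rfl
    exact ⟨[], 0, ⟨.nil _, List.nodup_nil, fun φ => by simp, fun _ _ => rfl, by simp⟩, by simp⟩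
  · obtain ⟨p, g, h, -⟩ := good_union x hx
    exact ⟨p, g, h⟩

/-- Integral max-flow min-cut for unit capacities. -/
theorem exists_isFlow_of_le_cut [Fintype E] {tail head : E → V} {a b : V} {n : ℕ}
    (hcut : ∀ T : Set V, a ∈ T → b ∉ T → n ≤ {e | ¬(tail e ∈ T ↔ head e ∈ T)}.ncard) :
    ∀ k ≤ n, ∃ f : E → ℤ, IsFlow tail head a b k f ∧ ∀ e, -1 ≤ f e ∧ f e ≤ 1 := by
  classical
  intro k
  induction k with
  | zero => exact fun _ => ⟨0, fun φ => by simp, fun e => by simp⟩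
  | succ k ih =>
    intro hk
    obtain ⟨f, hf, hb⟩ := ih (by omega)
    obtain ⟨T, haT, h₁, h₂, hT⟩ :=
      exists_closed_set_unitFlow tail head (fun e s => f e * s ≤ 0) a
    by_cases hbT : b ∈ T
    · obtain ⟨p, g, hg⟩ := hT b hbT
      refine ⟨_, by push_cast; exact hf.add hg.isFlow, fun e => ?_⟩
      by_cases he : e ∈ p
      · have := hb e
        obtain ⟨h | h, hR⟩ := hg.step e he <;> rw [h] at hR ⊢ <;> constructor <;> linarith
      · simpa [hg.eq_zero e he] using hb e
    · exfalso
      have hsum := hf (fun v => if v ∈ T then 1 else 0)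
      have hc := hcut T haT hbT
      rw [Set.ncard_eq_toFinset_card', Set.toFinset_ofPred, Finset.card_filter] at hc
      rw [Finset.sum_congr rfl (g := fun e => if ¬(tail e ∈ T ↔ head e ∈ T) then 1 else 0)] at hsum
      · simp only [haT, hbT, if_true, if_false, sub_zero, mul_one] at hsum
        have : n ≤ k := by
          zify
          zify at hc
          rw [← hsum]
          exact hc
        omega
      · intro e _
        have hbe := hb e
        have h₁e := h₁ e
        have h₂e := h₂ e
        clear hb h₁ h₂ hsum
        by_cases ht : tail e ∈ T <;> by_cases hh : head e ∈ T <;> simp_all <;> omega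

/-- A flow with unit capacities decomposes into edge-disjoint trails. -/
theorem edgeDisjointPathsIn_of_isFlow [Fintype E] {tail head : E → V} {a b : V} :
    ∀ (k : ℕ) (f : E → ℤ), IsFlow tail head a b k f → (∀ e, -1 ≤ f e ∧ f e ≤ 1) →
      EdgeDisjointPathsIn (fun e => s(tail e, head e)) {e | f e ≠ 0} k a b := by
  classical
  intro k
  induction k with
  | zero => exact fun f _ _ => ⟨Fin.elim0, fun i => i.elim0, fun i => i.elim0⟩
  | succ k ih =>
    intro f hf hb
    obtain ⟨T, haT, h₁, h₂, hT⟩ := exists_closed_set_unitFlow tail head (fun e s => f e = s) a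
    have hbT : b ∈ T := by
      by_contra hbT
      have hsum := hf (fun v => if v ∈ T then 1 else 0)
      simp only [haT, hbT, if_true, if_false, sub_zero, mul_one] at hsum
      have hle : ∑ e, f e * ((if tail e ∈ T then 1 else 0) - if head e ∈ T then 1 else 0) ≤ 0 := by
        refine Finset.sum_nonpos fun e _ => ?_
        have hbe := hb e
        have h₁e := h₁ e
        have h₂e := h₂ e
        clear hb h₁ h₂ hsum
        by_cases ht : tail e ∈ T <;> by_cases hh : head e ∈ T <;> simp_all <;> omega
      omega
    obtain ⟨p, g, hg⟩ := hT b hbT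
    have hp : ∀ e ∈ p, f e - g e = 0 := fun e he => by rw [(hg.step e he).2, sub_self]
    have hnp : ∀ e ∉ p, f e - g e = f e := fun e he => by rw [hg.eq_zero e he, sub_zero]
    obtain ⟨P, hP, hdisj⟩ := ih (fun e => f e - g e)
      (by simpa using hf.sub hg.isFlow) fun e => by
        by_cases he : e ∈ p
        · simp [hp e he]
        · simpa only [hnp e he] using hb e
    have hPp : ∀ i, ∀ e ∈ P i, e ∉ p := fun i e he hep => (hP i).2.2 e he (hp e hep)
    refine ⟨Fin.cons p P, fun i => ?_, fun i j hij => ?_⟩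
    · refine Fin.cases ?_ (fun i => ?_) i
      · refine ⟨hg.isWalk, hg.nodup, fun e he => ?_⟩
        obtain ⟨h, hR⟩ := hg.step e he
        simp only [Set.mem_ofPred_eq, hR]
        omega
      · refine ⟨(hP i).1, (hP i).2.1, fun e he => ?_⟩
        have := (hP i).2.2 e he
        simpa only [Set.mem_ofPred_eq, hnp e (hPp i e he)] using this
    · cases i using Fin.cases with
      | zero =>
        cases j using Fin.cases with
        | zero => exact absurd rfl hij
        | succ j => exact fun e he hej => hPp j e hej he
      | succ i =>
        cases j using Fin.cases with
        | zero => exact fun e he hej => hPp i e he hej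
        | succ j => exact hdisj i j fun h => hij (h ▸ rfl)

/-- Common paths force every edge cut separating their starting points to be large. -/
theorem CommonPaths.le_two_mul_ncard_cut [Finite E] {tail head : E → V} {n : ℕ} {a b : V}
    (h : CommonPaths (fun e => s(tail e, head e)) n a b) {T : Set V} (ha : a ∈ T) (hb : b ∉ T) :
    n ≤ 2 * {e | ¬(tail e ∈ T ↔ head e ∈ T)}.ncard := by
  classical
  obtain ⟨P, Q, t, hP, hQ, hPd, hQd⟩ := h
  have key : ∀ i, ∃ d : {e | ¬(tail e ∈ T ↔ head e ∈ T)} × Bool,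
      (d.1 : E) ∈ if d.2 then P i else Q i := by
    intro i
    by_cases ht : t i ∈ T
    · obtain ⟨e, he, hc⟩ := (hQ i).1.exists_crossing_s10 (T := T) (by tauto)
      exact ⟨(⟨e, hc⟩, false), by simpa using he⟩
    · obtain ⟨e, he, hc⟩ := (hP i).1.exists_crossing_s10 (T := T) (by tauto)
      exact ⟨(⟨e, hc⟩, true), by simpa using he⟩
  choose d hd using key
  have hinj : Function.Injective d := by
    intro i j hij
    by_contra hne
    have hi := hd i
    have hj := hd j
    rw [← hij] at hj
    split_ifs at hi hj
    exacts [hPd i j hne _ hi hj, hQd i j hne _ hi hj]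
  have := Nat.card_le_card_of_injective d hinj
  rw [Nat.card_prod, Nat.card_fin, Nat.card_coe_set_eq, Nat.card_eq_fintype_card,
    Fintype.card_bool] at this
  omega

/-- If `v1` and `v2` have `2λ+1` common paths in `G`, then
there exist `λ+1` pairwise edge-disjoint paths from `v1` to `v2` in `G`. -/
theorem common_paths_to_connectivity {V E : Type} [Fintype V] [Fintype E]
    (ends : E → Sym2 V) (l : ℕ) (v1 v2 : V)
    (h : CommonPaths ends (2 * l + 1) v1 v2) :
    EdgeDisjointPathsIn ends Set.univ (l + 1) v1 v2 := by
  obtain ⟨o, rfl⟩ : ∃ o : E → V × V, ends = fun e => s((o e).1, (o e).2) :=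
    ⟨fun e => (ends e).out, funext fun e => (Quot.out_eq (ends e)).symm⟩
  obtain ⟨f, hf, hb⟩ := exists_isFlow_of_le_cut (n := l + 1)
    (tail := fun e => (o e).1) (head := fun e => (o e).2) (a := v1) (b := v2)
    (fun T ha hb => by have := CommonPaths.le_two_mul_ncard_cut h ha hb; omega) (l + 1) le_rfl
  obtain ⟨P, hP, hd⟩ := edgeDisjointPathsIn_of_isFlow (l + 1) f hf hb
  exact ⟨P, fun i => ⟨(hP i).1, (hP i).2.1, fun _ _ => Set.mem_univ _⟩, hd⟩

end SteinerPacking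
end
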